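/- arXiv:1411.5572 — 2 statements merged into one kernel-verified Lean document; each statement's English description precedes it below -/
import Mathlib

section
/- For p = (x, y, z, t, P, Q, U, V) ∈ ℝ⁸ let ĝ(p) be the 8×8 real symmetric matrix (indices 1,…,8 corresponding to x, y, z, t, P, Q, U, V) whose only nonzero entries are ĝ₁₃ = ĝ₃₁ = −2V, ĝ₁₄ = ĝ₄₁ = 2Q, ĝ₃₃ = 4tV, ĝ₃₄ = ĝ₄₃ = 2P, ĝ₁₅ = ĝ₅₁ = 1, ĝ₂₆ = ĝ₆₂ = 1, ĝ₃₇ = ĝ₇₃ = 1, ĝ₄₈ = ĝ₈₄ = 1. Then for every p ∈ ℝ⁸: (i) det ĝ(p) = 1, so ĝ(p) is invertible; (ii) with Γ^k_{ij}(p) = (1/2)·Σ_l (ĝ(p)⁻¹)_{kl}·(∂_i ĝ_{jl}(p) + ∂_j ĝ_{il}(p) − ∂_l ĝ_{ij}(p)) and Ric_{ij}(p) = Σ_k (∂_k Γ^k_{ij}(p) − ∂_j Γ^k_{ik}(p)) + Σ_{k,l} (Γ^k_{kl}(p)·Γ^l_{ij}(p) − Γ^k_{jl}(p)·Γ^l_{ik}(p)),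 one has Ric_{ij}(p) = 0 for all i, j. That is, the eight-dimensional Riemann extension of the anti-Mach metric is Ricci-flat. -/
/-- Partial derivative of a scalar function on ℝⁿ (coordinates `Fin n → ℝ`) in the
`i`-th coordinate direction. -/
noncomputable def coordPartialDeriv {n : ℕ} (i : Fin n) (f : (Fin n → ℝ) → ℝ)
    (p : Fin n → ℝ) : ℝ :=
  fderiv ℝ f p (Pi.single i 1)

/-- Matrix of the Riemann extension of the anti-Mach metric,
ds² = 4P dz dt + 4Q dx dt − 4V dx dz + 4tV dz² + 2 dx dP + 2 dy dQ + 2 dz dU + 2 dt dV,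
in the coordinates (x, y, z, t, P, Q, U, V) = (p 0, …, p 7). -/
noncomputable def antiMachExtMetric (p : Fin 8 → ℝ) : Matrix (Fin 8) (Fin 8) ℝ :=
  !![0, 0, -2 * p 7, 2 * p 5, 1, 0, 0, 0;
     0, 0, 0, 0, 0, 1, 0, 0;
     -2 * p 7, 0, 4 * p 3 * p 7, 2 * p 4, 0, 0, 1, 0;
     2 * p 5, 0, 2 * p 4, 0, 0, 0, 0, 1;
     1, 0, 0, 0, 0, 0, 0, 0;
     0, 1, 0, 0, 0, 0, 0, 0;
     0, 0, 1, 0, 0, 0, 0, 0;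
     0, 0, 0, 1, 0, 0, 0, 0]

/-- Christoffel symbols of the second kind of the Riemann-extended anti-Mach metric:
Γ^k_{ij} = (1/2) Σ_l (ĝ⁻¹)_{kl} (∂_i ĝ_{jl} + ∂_j ĝ_{il} − ∂_l ĝ_{ij}). -/
noncomputable def antiMachExtChristoffel (k i j : Fin 8) (p : Fin 8 → ℝ) : ℝ :=
  (1 / 2) * ∑ l, (antiMachExtMetric p)⁻¹ k l *
    (coordPartialDeriv i (fun q => antiMachExtMetric q j l) p
      + coordPartialDeriv j (fun q => antiMachExtMetric q i l) p
      - coordPartialDeriv l (fun q => antiMachExtMetric q i j) p)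

/-- Ricci tensor of the Riemann-extended anti-Mach metric:
Ric_{ij} = Σ_k (∂_k Γ^k_{ij} − ∂_j Γ^k_{ik}) + Σ_{k,l} (Γ^k_{kl}Γ^l_{ij} − Γ^k_{jl}Γ^l_{ik}). -/
noncomputable def antiMachExtRicci (i j : Fin 8) (p : Fin 8 → ℝ) : ℝ :=
  (∑ k, (coordPartialDeriv k (antiMachExtChristoffel k i j) p
    - coordPartialDeriv j (antiMachExtChristoffel k i k) p))
  + ∑ k, ∑ l, (antiMachExtChristoffel k k l p * antiMachExtChristoffel l i j p
    - antiMachExtChristoffel k j l p * antiMachExtChristoffel l i k p)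

/-! Partial derivatives of the monomials that occur. -/

lemma cpd_const (a : Fin 8) (c : ℝ) (p : Fin 8 → ℝ) :
    coordPartialDeriv a (fun _ => c) p = 0 := by
  simp [coordPartialDeriv]

lemma cpd_lin (a b : Fin 8) (c : ℝ) (p : Fin 8 → ℝ) :
    coordPartialDeriv a (fun q => c * q b) p = if b = a then c else 0 := by
  have h : HasFDerivAt (fun q : Fin 8 → ℝ => c * q b)
      (c • (ContinuousLinearMap.proj b : (Fin 8 → ℝ) →L[ℝ] ℝ)) p :=
    (hasFDerivAt_apply b p).const_mul c
  simp [coordPartialDeriv, h.fderiv, Pi.single_apply]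

lemma cpd_quad (a b d : Fin 8) (c : ℝ) (p : Fin 8 → ℝ) :
    coordPartialDeriv a (fun q => c * q b * q d) p
      = (if d = a then c * p b else 0) + (if b = a then c * p d else 0) := by
  have h1 : HasFDerivAt (fun q : Fin 8 → ℝ => c * q b)
      (c • (ContinuousLinearMap.proj b : (Fin 8 → ℝ) →L[ℝ] ℝ)) p :=
    (hasFDerivAt_apply b p).const_mul c
  have h := h1.mul (hasFDerivAt_apply (𝕜 := ℝ) d p)
  have e : fderiv ℝ (fun q : Fin 8 → ℝ => c * q b * q d) p = _ := h.fderiv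
  unfold coordPartialDeriv
  rw [e]
  simp [Pi.single_apply, mul_comm]

/-- The inverse of the metric. -/
noncomputable def metInv (p : Fin 8 → ℝ) : Matrix (Fin 8) (Fin 8) ℝ :=
  !![0, 0, 0, 0, 1, 0, 0, 0;
     0, 0, 0, 0, 0, 1, 0, 0;
     0, 0, 0, 0, 0, 0, 1, 0;
     0, 0, 0, 0, 0, 0, 0, 1;
     1, 0, 0, 0, 0, 0, 2 * p 7, -2 * p 5;
     0, 1, 0, 0, 0, 0, 0, 0;
     0, 0, 1, 0, 2 * p 7, 0, -4 * p 3 * p 7, -2 * p 4;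
     0, 0, 0, 1, -2 * p 5, 0, -2 * p 4, 0]

lemma met_mul_inv (p : Fin 8 → ℝ) : antiMachExtMetric p * metInv p = 1 := by
  ext i j
  fin_cases i <;> fin_cases j <;>
    simp [antiMachExtMetric, metInv, Matrix.mul_apply, Fin.sum_univ_eight]

lemma met_inv (p : Fin 8 → ℝ) : (antiMachExtMetric p)⁻¹ = metInv p :=
  Matrix.inv_eq_right_inv (met_mul_inv p)

/-- Unipotent factor of the metric. -/
noncomputable def metL (p : Fin 8 → ℝ) : Matrix (Fin 8) (Fin 8) ℝ :=
  !![1, 0, 0, 0, 0, 0, -2 * p 7, 2 * p 5;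
     0, 1, 0, 0, 0, 0, 0, 0;
     0, 0, 1, 0, -2 * p 7, 0, 4 * p 3 * p 7, 2 * p 4;
     0, 0, 0, 1, 2 * p 5, 0, 2 * p 4, 0;
     0, 0, 0, 0, 1, 0, 0, 0;
     0, 0, 0, 0, 0, 1, 0, 0;
     0, 0, 0, 0, 0, 0, 1, 0;
     0, 0, 0, 0, 0, 0, 0, 1]

/-- The permutation exchanging base and fibre coordinates. -/
def swapPerm : Equiv.Perm (Fin 8) where
  toFun := ![4, 5, 6, 7, 0, 1, 2, 3]
  invFun := ![4, 5, 6, 7, 0, 1, 2, 3]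
  left_inv := by decide
  right_inv := by decide

lemma met_factor (p : Fin 8 → ℝ) :
    antiMachExtMetric p = (metL p).submatrix id swapPerm := by
  ext i j
  fin_cases i <;> fin_cases j <;> simp [antiMachExtMetric, metL, swapPerm]

lemma metL_det (p : Fin 8 → ℝ) : (metL p).det = 1 := by
  rw [Matrix.det_of_isUpperTriangular]
  · simp [metL, Fin.prod_univ_eight]
  · intro i j hij
    fin_cases i <;> fin_cases j <;>
      first
      | rfl
      | exact absurd hij (by decide)

lemma swapPerm_sign : Equiv.Perm.sign swapPerm = 1 := by decide

lemma met_det (p : Fin 8 → ℝ) : (antiMachExtMetric p).det = 1 := by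
  rw [met_factor, Matrix.det_permute', metL_det, swapPerm_sign]
  simp

/-- Derivative of the metric in direction 3. -/
noncomputable def dMet3 (p : Fin 8 → ℝ) (i j : Fin 8) : ℝ :=
  (!![0, 0, 0, 0, 0, 0, 0, 0;
     0, 0, 0, 0, 0, 0, 0, 0;
     0, 0, 4 * p 7, 0, 0, 0, 0, 0;
     0, 0, 0, 0, 0, 0, 0, 0;
     0, 0, 0, 0, 0, 0, 0, 0;
     0, 0, 0, 0, 0, 0, 0, 0;
     0, 0, 0, 0, 0, 0, 0, 0;
     0, 0, 0, 0, 0, 0, 0, 0] : Matrix (Fin 8) (Fin 8) ℝ) i j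

/-- Derivative of the metric in direction 4. -/
noncomputable def dMet4 (_ : Fin 8 → ℝ) (i j : Fin 8) : ℝ :=
  (!![0, 0, 0, 0, 0, 0, 0, 0;
     0, 0, 0, 0, 0, 0, 0, 0;
     0, 0, 0, 2, 0, 0, 0, 0;
     0, 0, 2, 0, 0, 0, 0, 0;
     0, 0, 0, 0, 0, 0, 0, 0;
     0, 0, 0, 0, 0, 0, 0, 0;
     0, 0, 0, 0, 0, 0, 0, 0;
     0, 0, 0, 0, 0, 0, 0, 0] : Matrix (Fin 8) (Fin 8) ℝ) i j

/-- Derivative of the metric in direction 5. -/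
noncomputable def dMet5 (_ : Fin 8 → ℝ) (i j : Fin 8) : ℝ :=
  (!![0, 0, 0, 2, 0, 0, 0, 0;
     0, 0, 0, 0, 0, 0, 0, 0;
     0, 0, 0, 0, 0, 0, 0, 0;
     2, 0, 0, 0, 0, 0, 0, 0;
     0, 0, 0, 0, 0, 0, 0, 0;
     0, 0, 0, 0, 0, 0, 0, 0;
     0, 0, 0, 0, 0, 0, 0, 0;
     0, 0, 0, 0, 0, 0, 0, 0] : Matrix (Fin 8) (Fin 8) ℝ) i j

/-- Derivative of the metric in direction 7. -/
noncomputable def dMet7 (p : Fin 8 → ℝ) (i j : Fin 8) : ℝ :=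
  (!![0, 0, -2, 0, 0, 0, 0, 0;
     0, 0, 0, 0, 0, 0, 0, 0;
     -2, 0, 4 * p 3, 0, 0, 0, 0, 0;
     0, 0, 0, 0, 0, 0, 0, 0;
     0, 0, 0, 0, 0, 0, 0, 0;
     0, 0, 0, 0, 0, 0, 0, 0;
     0, 0, 0, 0, 0, 0, 0, 0;
     0, 0, 0, 0, 0, 0, 0, 0] : Matrix (Fin 8) (Fin 8) ℝ) i j

/-- The vanishing array. -/
noncomputable def zeroArr (_ _ : Fin 8) : ℝ := 0

/-- The partial derivative in direction `a` of the metric. -/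
noncomputable def dMet (a : Fin 8) (p : Fin 8 → ℝ) (i j : Fin 8) : ℝ :=
  ![zeroArr, zeroArr, zeroArr, dMet3 p, dMet4 p, dMet5 p, zeroArr, dMet7 p] a i j

set_option maxHeartbeats 4000000 in
lemma cpd_met (a i j : Fin 8) (p : Fin 8 → ℝ) :
    coordPartialDeriv a (fun q => antiMachExtMetric q i j) p = dMet a p i j := by
  fin_cases i <;> fin_cases j <;>
    first
    | exact (cpd_const a 0 p).trans (by fin_cases a <;> rfl)
    | exact (cpd_const a 1 p).trans (by fin_cases a <;> rfl)
    | exact (cpd_lin a 7 (-2) p).trans (by fin_cases a <;> rfl)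
    | exact (cpd_lin a 5 2 p).trans (by fin_cases a <;> rfl)
    | exact (cpd_lin a 4 2 p).trans (by fin_cases a <;> rfl)
    | exact (cpd_quad a 3 7 4 p).trans
        (by fin_cases a <;> first | exact zero_add _ | exact add_zero _)

/-- The Christoffel symbols with lower index 0. -/
noncomputable def gam0 (p : Fin 8 → ℝ) (k j : Fin 8) : ℝ :=
  (!![0, 0, 0, 0, 0, 0, 0, 0;
     0, 0, 0, -1, 0, 0, 0, 0;
     0, 0, 0, 0, 0, 0, 0, 0;
     0, 0, 1, 0, 0, 0, 0, 0;
     0, 0, -2 * p 5, 0, 0, 0, 0, 0;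
     0, 0, 0, 0, 0, 0, 0, 0;
     0, 0, -2 * p 4, 0, 0, 0, 0, -1;
     0, 0, 0, 0, 0, 1, 0, 0] : Matrix (Fin 8) (Fin 8) ℝ) k j

/-- The Christoffel symbols with lower index 2. -/
noncomputable def gam2 (p : Fin 8 → ℝ) (k j : Fin 8) : ℝ :=
  (!![0, 0, 0, -1, 0, 0, 0, 0;
     0, 0, 0, 0, 0, 0, 0, 0;
     0, 0, 0, 0, 0, 0, 0, 0;
     1, 0, -2 * p 3, 0, 0, 0, 0, 0;
     -2 * p 5, 0, 4 * p 3 * p 5, 0, 0, 0, 0, -1;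
     0, 0, 0, 0, 0, 0, 0, 0;
     -2 * p 4, 0, 4 * p 3 * p 4, 0, 0, 0, 0, 2 * p 3;
     0, 0, -2 * p 7, 2 * p 5, 1, 0, 0, 0] : Matrix (Fin 8) (Fin 8) ℝ) k j

/-- The Christoffel symbols with lower index 3. -/
noncomputable def gam3 (p : Fin 8 → ℝ) (k j : Fin 8) : ℝ :=
  (!![0, 0, -1, 0, 0, 0, 0, 0;
     -1, 0, 0, 0, 0, 0, 0, 0;
     0, 0, 0, 0, 0, 0, 0, 0;
     0, 0, 0, 0, 0, 0, 0, 0;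
     0, 0, 0, 0, 0, 1, 0, 0;
     0, 0, 0, 0, 0, 0, 0, 0;
     0, 0, 0, 0, 1, 0, 0, 0;
     0, 0, 2 * p 5, 0, 0, 0, 0, 0] : Matrix (Fin 8) (Fin 8) ℝ) k j

/-- The Christoffel symbols with lower index 4. -/
noncomputable def gam4 (p : Fin 8 → ℝ) (k j : Fin 8) : ℝ :=
  (!![0, 0, 0, 0, 0, 0, 0, 0;
     0, 0, 0, 0, 0, 0, 0, 0;
     0, 0, 0, 0, 0, 0, 0, 0;
     0, 0, 0, 0, 0, 0, 0, 0;
     0, 0, 0, 0, 0, 0, 0, 0;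
     0, 0, 0, 0, 0, 0, 0, 0;
     0, 0, 0, 1, 0, 0, 0, 0;
     0, 0, 1, 0, 0, 0, 0, 0] : Matrix (Fin 8) (Fin 8) ℝ) k j

/-- The Christoffel symbols with lower index 5. -/
noncomputable def gam5 (p : Fin 8 → ℝ) (k j : Fin 8) : ℝ :=
  (!![0, 0, 0, 0, 0, 0, 0, 0;
     0, 0, 0, 0, 0, 0, 0, 0;
     0, 0, 0, 0, 0, 0, 0, 0;
     0, 0, 0, 0, 0, 0, 0, 0;
     0, 0, 0, 1, 0, 0, 0, 0;
     0, 0, 0, 0, 0, 0, 0, 0;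
     0, 0, 0, 0, 0, 0, 0, 0;
     1, 0, 0, 0, 0, 0, 0, 0] : Matrix (Fin 8) (Fin 8) ℝ) k j

/-- The Christoffel symbols with lower index 7. -/
noncomputable def gam7 (p : Fin 8 → ℝ) (k j : Fin 8) : ℝ :=
  (!![0, 0, 0, 0, 0, 0, 0, 0;
     0, 0, 0, 0, 0, 0, 0, 0;
     0, 0, 0, 0, 0, 0, 0, 0;
     0, 0, 0, 0, 0, 0, 0, 0;
     0, 0, -1, 0, 0, 0, 0, 0;
     0, 0, 0, 0, 0, 0, 0, 0;
     -1, 0, 2 * p 3, 0, 0, 0, 0, 0;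
     0, 0, 0, 0, 0, 0, 0, 0] : Matrix (Fin 8) (Fin 8) ℝ) k j

/-- The Christoffel symbols `Γ^k_{ij}`. -/
noncomputable def gam (k i j : Fin 8) (p : Fin 8 → ℝ) : ℝ :=
  ![gam0 p, zeroArr, gam2 p, gam3 p, gam4 p, gam5 p, zeroArr, gam7 p] i k j

lemma sum_metInv (p : Fin 8 → ℝ) (X : Fin 8 → ℝ) (k : Fin 8) :
    ∑ l, metInv p k l * X l =
      ![X 4, X 5, X 6, X 7, X 0 + 2 * p 7 * X 6 - 2 * p 5 * X 7, X 1,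
        X 2 + 2 * p 7 * X 4 - 4 * p 3 * p 7 * X 6 - 2 * p 4 * X 7,
        X 3 - 2 * p 5 * X 4 - 2 * p 4 * X 6] k := by
  fin_cases k <;> simp [metInv, Fin.sum_univ_eight] <;> ring

/-! Shapes of the vanishing Christoffel symbols. -/

lemma zero_shape : (1 / 2 : ℝ) * (0 + 0 - 0) = 0 := by
  simp

lemma zero_shape4 (p : Fin 8 → ℝ) :
    (1 / 2 : ℝ) * ((0 + 0 - 0) + 2 * p 7 * (0 + 0 - 0) - 2 * p 5 * (0 + 0 - 0)) = 0 := by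
  simp

lemma zero_shape6 (p : Fin 8 → ℝ) :
    (1 / 2 : ℝ) * ((0 + 0 - 0) + 2 * p 7 * (0 + 0 - 0) - 4 * p 3 * p 7 * (0 + 0 - 0)
      - 2 * p 4 * (0 + 0 - 0)) = 0 := by
  simp

lemma zero_shape7 (p : Fin 8 → ℝ) :
    (1 / 2 : ℝ) * ((0 + 0 - 0) - 2 * p 5 * (0 + 0 - 0) - 2 * p 4 * (0 + 0 - 0)) = 0 := by
  simp

set_option maxHeartbeats 4000000 in
lemma christoffel_eq (k i j : Fin 8) (p : Fin 8 → ℝ) :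
    antiMachExtChristoffel k i j p = gam k i j p := by
  unfold antiMachExtChristoffel
  rw [met_inv]
  simp only [cpd_met]
  rw [sum_metInv p (fun l => dMet i p j l + dMet j p i l - dMet l p i j) k]
  fin_cases k <;> fin_cases i <;> fin_cases j <;>
    first
    | exact zero_shape
    | exact zero_shape4 p
    | exact zero_shape6 p
    | exact zero_shape7 p
    | (simp [dMet, dMet3, dMet4, dMet5, dMet7, zeroArr, gam, gam0, gam2, gam3, gam4, gam5, gam7, zeroArr]; done)
    | (simp [dMet, dMet3, dMet4, dMet5, dMet7, zeroArr, gam, gam0, gam2, gam3, gam4, gam5, gam7, zeroArr]; ring)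

/-- The partial derivatives of the Christoffel symbols. -/
noncomputable def dGam (a k i j : Fin 8) (p : Fin 8 → ℝ) : ℝ :=
  (![0,
     0,
     0,
     !![0, 0, 0, 0, 0, 0, 0, 0;
       0, 0, 0, 0, 0, 0, 0, 0;
       0, 0, if 3 = a then -2 else 0, 0, 0, 0, 0, 0;
       0, 0, 0, 0, 0, 0, 0, 0;
       0, 0, 0, 0, 0, 0, 0, 0;
       0, 0, 0, 0, 0, 0, 0, 0;
       0, 0, 0, 0, 0, 0, 0, 0;
       0, 0, 0, 0, 0, 0, 0, 0],
     !![0, 0, if 5 = a then -2 else 0, 0, 0, 0, 0, 0;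
       0, 0, 0, 0, 0, 0, 0, 0;
       if 5 = a then -2 else 0, 0, (if 5 = a then 4 * p 3 else 0) + (if 3 = a then 4 * p 5 else 0), 0, 0, 0, 0, 0;
       0, 0, 0, 0, 0, 0, 0, 0;
       0, 0, 0, 0, 0, 0, 0, 0;
       0, 0, 0, 0, 0, 0, 0, 0;
       0, 0, 0, 0, 0, 0, 0, 0;
       0, 0, 0, 0, 0, 0, 0, 0],
     0,
     !![0, 0, if 4 = a then -2 else 0, 0, 0, 0, 0, 0;
       0, 0, 0, 0, 0, 0, 0, 0;
       if 4 = a then -2 else 0, 0, (if 4 = a then 4 * p 3 else 0) + (if 3 = a then 4 * p 4 else 0), 0, 0, 0, 0, if 3 = a then 2 else 0;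
       0, 0, 0, 0, 0, 0, 0, 0;
       0, 0, 0, 0, 0, 0, 0, 0;
       0, 0, 0, 0, 0, 0, 0, 0;
       0, 0, 0, 0, 0, 0, 0, 0;
       0, 0, if 3 = a then 2 else 0, 0, 0, 0, 0, 0],
     !![0, 0, 0, 0, 0, 0, 0, 0;
       0, 0, 0, 0, 0, 0, 0, 0;
       0, 0, if 7 = a then -2 else 0, if 5 = a then 2 else 0, 0, 0, 0, 0;
       0, 0, if 5 = a then 2 else 0, 0, 0, 0, 0, 0;
       0, 0, 0, 0, 0, 0, 0, 0;
       0, 0, 0, 0, 0, 0, 0, 0;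
       0, 0, 0, 0, 0, 0, 0, 0;
       0, 0, 0, 0, 0, 0, 0, 0]] : Fin 8 → Matrix (Fin 8) (Fin 8) ℝ) k i j

set_option maxHeartbeats 4000000 in
lemma cpd_christoffel (a k i j : Fin 8) (p : Fin 8 → ℝ) :
    coordPartialDeriv a (antiMachExtChristoffel k i j) p = dGam a k i j p := by
  have h : antiMachExtChristoffel k i j = gam k i j := by
    funext q
    exact christoffel_eq k i j q
  rw [h]
  fin_cases k <;> fin_cases i <;> fin_cases j <;>
    first
    | exact cpd_const a 0 p
    | exact cpd_const a 1 p
    | exact cpd_const a (-1) p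
    | exact cpd_lin a 3 (-2) p
    | exact cpd_lin a 3 2 p
    | exact cpd_lin a 4 (-2) p
    | exact cpd_lin a 5 (-2) p
    | exact cpd_lin a 5 2 p
    | exact cpd_lin a 7 (-2) p
    | exact cpd_quad a 3 5 4 p
    | exact cpd_quad a 3 4 4 p

lemma gam_trace (p : Fin 8 → ℝ) (k l : Fin 8) : gam k k l p = 0 := by
  fin_cases k <;> fin_cases l <;> rfl

lemma dGam_trace (p : Fin 8 → ℝ) (j k i : Fin 8) : dGam j k i k p = 0 := by
  fin_cases k <;> fin_cases i <;> rfl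

set_option maxHeartbeats 4000000 in
lemma dGam_div (p : Fin 8 → ℝ) (k i j : Fin 8) :
    dGam k k i j p = if i = 2 ∧ j = 2 ∧ (k = 3 ∨ k = 7) then -2 else 0 := by
  fin_cases k <;> fin_cases i <;> fin_cases j <;>
    first
    | rfl
    | exact add_zero (0 : ℝ)

set_option maxHeartbeats 4000000 in
lemma gam_contract (p : Fin 8 → ℝ) (Y : Fin 8 → Fin 8 → ℝ) (j : Fin 8) :
    ∑ k, ∑ l, gam k j l p * Y k l =
      ![(-1) * Y 1 3 + (1) * Y 3 2 + (-2 * p 5) * Y 4 2 + (-2 * p 4) * Y 6 2 + (-1) * Y 6 7 + (1) * Y 7 5,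
        0,
        (-1) * Y 0 3 + (1) * Y 3 0 + (-2 * p 3) * Y 3 2 + (-2 * p 5) * Y 4 0 + (4 * p 3 * p 5) * Y 4 2 + (-1) * Y 4 7 + (-2 * p 4) * Y 6 0 + (4 * p 3 * p 4) * Y 6 2 + (2 * p 3) * Y 6 7 + (-2 * p 7) * Y 7 2 + (2 * p 5) * Y 7 3 + (1) * Y 7 4,
        (-1) * Y 0 2 + (-1) * Y 1 0 + (1) * Y 4 5 + (1) * Y 6 4 + (2 * p 5) * Y 7 2,
        (1) * Y 6 3 + (1) * Y 7 2,
        (1) * Y 4 3 + (1) * Y 7 0,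
        0,
        (-1) * Y 4 2 + (-1) * Y 6 0 + (2 * p 3) * Y 6 2] j := by
  simp only [Fin.sum_univ_eight]
  fin_cases j <;> simp [gam, gam0, gam2, gam3, gam4, gam5, gam7, zeroArr] <;> ring

set_option maxHeartbeats 4000000 in
lemma gam_quad (p : Fin 8 → ℝ) (i j : Fin 8) :
    ∑ k, ∑ l, gam k j l p * gam l i k p = if i = 2 ∧ j = 2 then -4 else 0 := by
  rw [gam_contract p (fun k l => gam l i k p) j]
  fin_cases j <;> fin_cases i <;> simp [gam, gam0, gam2, gam3, gam4, gam5, gam7, zeroArr] <;> ring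

/-- The eight-dimensional Riemann extension of the anti-Mach metric has determinant 1
(hence is invertible) and is Ricci-flat. -/
theorem antiMach_extension_ricci_flat :
    ∀ p : Fin 8 → ℝ,
      (antiMachExtMetric p).det = 1 ∧
      ∀ i j : Fin 8, antiMachExtRicci i j p = 0 := by
  intro p
  refine ⟨met_det p, fun i j => ?_⟩
  unfold antiMachExtRicci
  simp only [cpd_christoffel, christoffel_eq, Finset.sum_sub_distrib]
  rw [gam_quad]
  simp only [gam_trace, dGam_trace, dGam_div, Fin.sum_univ_eight]
  by_cases hi : i = 2 <;> by_cases hj : j = 2 <;> simp [hi, hj]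
  norm_num
end

section
/- Let f, g : ℝ → ℝ be continuous and nonconstant, let C₃ ∈ ℝ, and let G₁, G₂ : ℝ → ℝ be arbitrary. Define y(u,v) = −2C₃f(u)g(v) − f(u)²g(v) − g(v)²f(u) + G₁(u) + G₂(v). Then there do NOT exist functions F, G : ℝ → ℝ such that y(u,v) = F(u) + G(v) for all (u,v) ∈ ℝ². In particular, the y-coordinate of the general solution of the translation-surface system of the anti-Mach metric is not a sum of a function of u and a function of v, so no translation surface of the anti-Mach metric exists in the full four-dimensional space. -/
/-- Nonexistence of four-dimensional translation surfaces for the anti-Mach metric: if f and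
g are continuous and nonconstant, the coordinate y(u,v) = −2C₃fg − f²g − g²f + G₁ + G₂ of the
general solution of the translation-surface system is not a sum of a function of u alone and
a function of v alone. -/
theorem antiMach_no_translation_surface_in_4d (f g G₁ G₂ : ℝ → ℝ) (C₃ : ℝ)
    (hf : Continuous f) (hg : Continuous g)
    (hfnc : ¬ ∃ c : ℝ, ∀ u, f u = c) (hgnc : ¬ ∃ c : ℝ, ∀ v, g v = c)
    (y : ℝ → ℝ → ℝ)
    (hy : ∀ u v, y u v = -2 * C₃ * f u * g v - (f u) ^ 2 * g v - (g v) ^ 2 * f u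
      + G₁ u + G₂ v) :
    ¬ ∃ F G : ℝ → ℝ, ∀ u v, y u v = F u + G v := by
  rintro ⟨F, G, h⟩
  push Not at hfnc hgnc
  obtain ⟨p, hp⟩ := hfnc (f 0)
  obtain ⟨q, hq⟩ := hgnc (g 0)
  -- the mixed second difference of `y` vanishes
  have key : ∀ u, (f u - f 0) * ((g q - g 0) * (2 * C₃ + f u + f 0 + g q + g 0)) = 0 := by
    intro u
    have h1 := (hy u q).symm.trans (h u q)
    have h2 := (hy u 0).symm.trans (h u 0)
    have h3 := (hy 0 q).symm.trans (h 0 q)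
    have h4 := (hy 0 0).symm.trans (h 0 0)
    linear_combination -h1 + h2 + h3 - h4
  have key2 : ∀ u, f u ≠ f 0 → 2 * C₃ + f u + f 0 + g q + g 0 = 0 := by
    intro u hu
    exact (mul_eq_zero.1 ((mul_eq_zero.1 (key u)).resolve_left (sub_ne_zero.2 hu))).resolve_left
      (sub_ne_zero.2 hq)
  -- the midpoint of `f 0` and `f p` is attained by continuity
  have hm : ∃ m, f m = (f 0 + f p) / 2 := by
    rcases le_total (f 0) (f p) with hle | hle
    · exact mem_range_of_exists_le_of_exists_ge hf ⟨0, by linarith⟩ ⟨p, by linarith⟩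
    · exact mem_range_of_exists_le_of_exists_ge hf ⟨p, by linarith⟩ ⟨0, by linarith⟩
  obtain ⟨m, hm⟩ := hm
  have e1 := key2 p hp
  have e2 := key2 m (fun e => hp (by linarith))
  exact hp (by linarith)
end
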